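/- arXiv:2204.10693 — 5 statements merged into one kernel-verified Lean document; each statement's English description precedes it below -/
import Mathlib

section
/- Let q be a positive integer and λ a real number. The polynomial X² + 1 divides the real polynomial 4 + λ·X^(4q)·(1 - X)^(4q) if and only if λ = (-1/4)^(q-1). -/
open Polynomial

theorem divides_iff_lambda (q : ℕ) (hq : 0 < q) (lam : ℝ) :
    (X ^ 2 + 1 : ℝ[X]) ∣ (C 4 + C lam * X ^ (4 * q) * (1 - X) ^ (4 * q)) ↔
      lam = (-1 / 4 : ℝ) ^ (q - 1) := by
  have h1 : (X ^ 2 + 1 : ℝ[X]) ∣ (X ^ 4 * (1 - X) ^ 4) - (-4) :=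
    ⟨X ^ 6 - 4 * X ^ 5 + 5 * X ^ 4 - 4 * X ^ 2 + 4, by ring⟩
  have h2 : (X ^ 2 + 1 : ℝ[X]) ∣ (X ^ 4 * (1 - X) ^ 4) ^ q - (-4) ^ q :=
    h1.trans (sub_dvd_pow_sub_pow _ _ q)
  have h3 : (C 4 + C lam * X ^ (4 * q) * (1 - X) ^ (4 * q) : ℝ[X])
      = C lam * ((X ^ 4 * (1 - X) ^ 4) ^ q - (-4) ^ q) + C (4 + lam * (-4) ^ q) := by
    have h4 : (C (4 + lam * (-4) ^ q) : ℝ[X]) = C 4 + C lam * (-4) ^ q := by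
      rw [C_add, C_mul, C_pow, C_neg]; rfl
    rw [h4, mul_pow, ← pow_mul, ← pow_mul]
    ring
  rw [h3, dvd_add_right (Dvd.dvd.mul_left h2 _)]
  have hdeg : (X ^ 2 + 1 : ℝ[X]).natDegree = 2 := by compute_degree!
  have h5 : (X ^ 2 + 1 : ℝ[X]) ∣ C (4 + lam * (-4) ^ q) ↔ 4 + lam * (-4) ^ q = 0 := by
    constructor
    · intro h
      by_contra hne
      have := natDegree_le_of_dvd h (C_ne_zero.mpr hne)
      rw [hdeg, natDegree_C] at this
      omega
    · intro h
      rw [h, C_0]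
      exact dvd_zero _
  rw [h5]
  obtain ⟨k, rfl⟩ : ∃ k, q = k + 1 := ⟨q - 1, by omega⟩
  have h6 : (-1 / 4 : ℝ) ^ k * (-4) ^ k = 1 := by
    rw [← mul_pow]; norm_num
  have h7 : ((-4 : ℝ)) ^ k ≠ 0 := pow_ne_zero _ (by norm_num)
  rw [Nat.add_sub_cancel, pow_succ]
  constructor
  · intro h
    apply mul_right_cancel₀ h7
    linarith
  · rintro rfl
    linarith
end

section
/- For every positive integer p, with q = 2p one has A_{2p} + (1/2^(4p-1))·B(8p+1, 8p+1) < π < A_{2p} + (1/2^(4p-2))·B(8p+1, 8p+1), where B(8p+1, 8p+1) = ((8p)!)²/(16p+1)!. -/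
open Real

lemma beta_aux (n : ℕ) : (∫ x in (0:ℝ)..1, x ^ n * (1 - x) ^ n) =
    (Nat.factorial n : ℝ) ^ 2 / (Nat.factorial (2 * n + 1) : ℝ) := by
  have h := Complex.betaIntegral_eq_Gamma_mul_div ((n:ℂ) + 1) ((n:ℂ) + 1)
    (by simp; positivity) (by simp; positivity)
  have e : ((n:ℂ) + 1) + ((n:ℂ) + 1) = ((2 * n + 1 : ℕ) : ℂ) + 1 := by push_cast; ring
  rw [e, Complex.Gamma_nat_eq_factorial, Complex.Gamma_nat_eq_factorial, Complex.betaIntegral] at h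
  simp only [add_sub_cancel_right, Complex.cpow_natCast] at h
  apply Complex.ofReal_injective
  rw [← intervalIntegral.integral_ofReal]
  push_cast
  rw [h, sq]

lemma pi_aux : (∫ x in (0:ℝ)..1, 4 / (x ^ 2 + 1)) = π := by
  have h : ∀ x : ℝ, 4 / (x ^ 2 + 1) = 4 * (1 / (1 + x ^ 2)) := by
    intro x; rw [add_comm]; ring
  simp_rw [h]
  rw [intervalIntegral.integral_const_mul, integral_one_div_one_add_sq]
  simp
  ring

theorem even_case_bounds (p : ℕ) (hp : 0 < p) :
    (∫ x in (0:ℝ)..1,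
        (4 + (-1/4 : ℝ) ^ (2 * p - 1) * x ^ (4 * (2 * p)) * (1 - x) ^ (4 * (2 * p))) / (x ^ 2 + 1)) +
        (1 / 2 ^ (4 * p - 1)) * ((Nat.factorial (8 * p) : ℝ) ^ 2 / (Nat.factorial (16 * p + 1) : ℝ)) < π ∧
      π < (∫ x in (0:ℝ)..1,
        (4 + (-1/4 : ℝ) ^ (2 * p - 1) * x ^ (4 * (2 * p)) * (1 - x) ^ (4 * (2 * p))) / (x ^ 2 + 1)) +
        (1 / 2 ^ (4 * p - 2)) * ((Nat.factorial (8 * p) : ℝ) ^ 2 / (Nat.factorial (16 * p + 1) : ℝ)) := by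
  have hb := beta_aux (8 * p)
  rw [show 2 * (8 * p) + 1 = 16 * p + 1 by ring] at hb
  rw [← hb, show 4 * (2 * p) = 8 * p by ring]
  obtain ⟨c, hc, h0, h1, h2⟩ : ∃ c : ℝ, 0 < c ∧ (-1/4 : ℝ) ^ (2 * p - 1) = -c ∧
      (1 : ℝ) / 2 ^ (4 * p - 1) = c / 2 ∧ (1 : ℝ) / 2 ^ (4 * p - 2) = c := by
    obtain ⟨k, rfl⟩ : ∃ k, p = k + 1 := ⟨p - 1, by omega⟩
    refine ⟨1 / 2 ^ (4 * k + 2), by positivity, ?_, ?_, ?_⟩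
    · rw [show 2 * (k + 1) - 1 = 2 * k + 1 by omega, pow_succ, pow_mul, pow_add, pow_mul]
      rw [show (-1/4 : ℝ) ^ 2 = 16⁻¹ by norm_num, show (2:ℝ) ^ 4 = 16 by norm_num, inv_pow]
      field_simp
      norm_num
    · rw [show 4 * (k + 1) - 1 = 4 * k + 2 + 1 by omega, pow_succ]
      field_simp
    · rw [show 4 * (k + 1) - 2 = 4 * k + 2 by omega]
  rw [h0, h1, h2, ← pi_aux]
  generalize 8 * p = n
  have hd : ∀ x : ℝ, x ^ 2 + 1 ≠ 0 := fun x => by positivity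
  have c1 : Continuous fun x : ℝ => (4 + -c * x ^ n * (1 - x) ^ n) / (x ^ 2 + 1) :=
    Continuous.div (by fun_prop) (by fun_prop) hd
  have c2 : Continuous fun x : ℝ => 4 / (x ^ 2 + 1) :=
    Continuous.div (by fun_prop) (by fun_prop) hd
  have c3 : ∀ d : ℝ, Continuous fun x : ℝ => d * (x ^ n * (1 - x) ^ n) := fun d => by fun_prop
  rw [← intervalIntegral.integral_const_mul, ← intervalIntegral.integral_const_mul,
    ← intervalIntegral.integral_add (c1.intervalIntegrable _ _) ((c3 _).intervalIntegrable _ _),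
    ← intervalIntegral.integral_add (c1.intervalIntegrable _ _) ((c3 _).intervalIntegrable _ _)]
  have key1 : ∀ x : ℝ, 4 / (x ^ 2 + 1) - ((4 + -c * x ^ n * (1 - x) ^ n) / (x ^ 2 + 1)
      + c / 2 * (x ^ n * (1 - x) ^ n)) =
      c * (x ^ n * (1 - x) ^ n) * (1 - x ^ 2) / (2 * (x ^ 2 + 1)) := by
    intro x; have := hd x; field_simp; ring
  have key2 : ∀ x : ℝ, ((4 + -c * x ^ n * (1 - x) ^ n) / (x ^ 2 + 1)
      + c * (x ^ n * (1 - x) ^ n)) - 4 / (x ^ 2 + 1) =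
      c * (x ^ n * (1 - x) ^ n) * x ^ 2 / (x ^ 2 + 1) := by
    intro x; have := hd x; field_simp; ring
  constructor
  · apply intervalIntegral.integral_lt_integral_of_continuousOn_of_le_of_exists_lt one_pos
      (c1.add (c3 _)).continuousOn c2.continuousOn
    · intro x hx
      rw [← sub_nonneg, Pi.add_apply, key1]
      have a := hx.1
      have b : 0 ≤ 1 - x := by linarith [hx.2]
      have d : 0 ≤ 1 - x ^ 2 := by nlinarith
      positivity
    · refine ⟨1/2, by norm_num, ?_⟩
      rw [← sub_pos, Pi.add_apply, key1]
      norm_num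
      positivity
  · apply intervalIntegral.integral_lt_integral_of_continuousOn_of_le_of_exists_lt one_pos
      c2.continuousOn (c1.add (c3 _)).continuousOn
    · intro x hx
      rw [← sub_nonneg, Pi.add_apply, key2]
      have a := hx.1
      have b : 0 ≤ 1 - x := by linarith [hx.2]
      positivity
    · refine ⟨1/2, by norm_num, ?_⟩
      rw [← sub_pos, Pi.add_apply, key2]
      norm_num
      positivity
end

section
/- ∫₀¹ (4 + (1/16)·x¹²·(1-x)¹²)/(x² + 1) dx = 431302721/137287920. -/
theorem A_three_eq :
    (∫ x in (0:ℝ)..1, (4 + (1/16 : ℝ) * x ^ 12 * (1 - x) ^ 12) / (x ^ 2 + 1)) =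
      431302721 / 137287920 := by
  have key : ∀ x : ℝ, (4 + (1/16 : ℝ) * x ^ 12 * (1 - x) ^ 12) / (x ^ 2 + 1) =
      (4) * x ^ 0 + (-4) * x ^ 2 + (4) * x ^ 4 + (-4) * x ^ 6 + (4) * x ^ 8 + (-4) * x ^ 10 + (65/16) * x ^ 12 + (-3/4) * x ^ 13 + (1/16) * x ^ 14 + (-13) * x ^ 15 + (247/8) * x ^ 16 + (-73/2) * x ^ 17 + (215/8) * x ^ 18 + (-13) * x ^ 19 + (65/16) * x ^ 20 + (-3/4) * x ^ 21 + (1/16) * x ^ 22 := by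
    intro x
    have h : x ^ 2 + 1 ≠ 0 := by positivity
    rw [div_eq_iff h]
    ring
  have hd : ∀ x : ℝ, HasDerivAt (fun x : ℝ => (4) * x ^ 1 + (-4/3) * x ^ 3 + (4/5) * x ^ 5 + (-4/7) * x ^ 7 + (4/9) * x ^ 9 + (-4/11) * x ^ 11 + (5/16) * x ^ 13 + (-3/56) * x ^ 14 + (1/240) * x ^ 15 + (-13/16) * x ^ 16 + (247/136) * x ^ 17 + (-73/36) * x ^ 18 + (215/152) * x ^ 19 + (-13/20) * x ^ 20 + (65/336) * x ^ 21 + (-3/88) * x ^ 22 + (1/368) * x ^ 23)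
      ((4) * x ^ 0 + (-4) * x ^ 2 + (4) * x ^ 4 + (-4) * x ^ 6 + (4) * x ^ 8 + (-4) * x ^ 10 + (65/16) * x ^ 12 + (-3/4) * x ^ 13 + (1/16) * x ^ 14 + (-13) * x ^ 15 + (247/8) * x ^ 16 + (-73/2) * x ^ 17 + (215/8) * x ^ 18 + (-13) * x ^ 19 + (65/16) * x ^ 20 + (-3/4) * x ^ 21 + (1/16) * x ^ 22) x := by
    intro x
    have h := ((((((((((((((((((hasDerivAt_pow 1 x).const_mul (4 : ℝ)).fun_add ((hasDerivAt_pow 3 x).const_mul (-4/3 : ℝ))).fun_add ((hasDerivAt_pow 5 x).const_mul (4/5 : ℝ))).fun_add ((hasDerivAt_pow 7 x).const_mul (-4/7 : ℝ))).fun_add ((hasDerivAt_pow 9 x).const_mul (4/9 : ℝ))).fun_add ((hasDerivAt_pow 11 x).const_mul (-4/11 : ℝ))).fun_add ((hasDerivAt_pow 13 x).const_mul (5/16 : ℝ))).fun_add ((hasDerivAt_pow 14 x).const_mul (-3/56 : ℝ))).fun_add ((hasDerivAt_pow 15 x).const_mul (1/240 : ℝ))).fun_add ((hasDerivAt_pow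 16 x).const_mul (-13/16 : ℝ))).fun_add ((hasDerivAt_pow 17 x).const_mul (247/136 : ℝ))).fun_add ((hasDerivAt_pow 18 x).const_mul (-73/36 : ℝ))).fun_add ((hasDerivAt_pow 19 x).const_mul (215/152 : ℝ))).fun_add ((hasDerivAt_pow 20 x).const_mul (-13/20 : ℝ))).fun_add ((hasDerivAt_pow 21 x).const_mul (65/336 : ℝ))).fun_add ((hasDerivAt_pow 22 x).const_mul (-3/88 : ℝ))).fun_add ((hasDerivAt_pow 23 x).const_mul (1/368 : ℝ)))
    refine h.congr_deriv ?_
    norm_num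
    ring
  simp_rw [key]
  rw [intervalIntegral.integral_eq_sub_of_hasDerivAt (fun x _ => hd x)
    (Continuous.intervalIntegrable (by fun_prop) _ _)]
  norm_num
end

section
/- ∫₀¹ (4 − (1/64)·x¹⁶·(1-x)¹⁶)/(x² + 1) dx = 741269838109/235953517800. -/
theorem A_four_eq :
    (∫ x in (0:ℝ)..1, (4 - (1/64 : ℝ) * x ^ 16 * (1 - x) ^ 16) / (x ^ 2 + 1)) =
      741269838109 / 235953517800 := by
  -- coefficients of the polynomial which equals `64` times the integrand
  let c : List ℝ := [256, 0, -256, 0, 256, 0, -256, 0, 256, 0, -256, 0, 256, 0, -256, 0, 255, 16,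
    -375, 544, -1445, 3824, -6563, 7616, -6307, 3824, -1701, 544, -119, 16, -1]
  have h : ∀ x : ℝ, (4 - (1/64 : ℝ) * x ^ 16 * (1 - x) ^ 16) / (x ^ 2 + 1) =
      ∑ i ∈ Finset.range 31, (c.getD i 0 / 64) * x ^ i := by
    intro x
    have hx : x ^ 2 + 1 ≠ 0 := by positivity
    rw [div_eq_iff hx]
    simp only [Finset.sum_range_succ, Finset.sum_range_zero, c, List.getD_cons_zero,
      List.getD_cons_succ]
    ring
  simp_rw [h]
  rw [intervalIntegral.integral_finset_sum]
  · simp only [intervalIntegral.integral_const_mul, integral_pow]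
    simp only [Finset.sum_range_succ, Finset.sum_range_zero, c, List.getD_cons_zero,
      List.getD_cons_succ]
    norm_num
  · intro i _
    exact Continuous.intervalIntegrable (by fun_prop) _ _
end

section
/- ∫₀¹ (4 + (1/256)·x²⁰·(1-x)²⁰)/(x² + 1) dx = 26856502742629699/8548690331301120. -/
/-- Coefficients of the quotient of `x^20 (1-x)^20 + 1024` by `x^2 + 1`. -/
def quotCoeff (i : ℕ) : ℤ :=
  [1024, 0, -1024, 0, 1024, 0, -1024, 0, 1024, 0, -1024, 0, 1024, 0, -1024, 0, 1024, 0, -1024, 0, 1025, -20, -835, -1120, 5680, -14384, 33080, -63136, 92890, -104824, 91866, -63136, 34104, -14384, 4656, -1120, 189, -20, 1].getD i 0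

theorem integral_quot (c : ℕ → ℤ) (n : ℕ) :
    (∫ x in (0:ℝ)..1, ∑ i ∈ Finset.range n, (c i : ℝ) * x ^ i) =
      ∑ i ∈ Finset.range n, (c i : ℝ) / (i + 1) := by
  rw [intervalIntegral.integral_finset_sum]
  · refine Finset.sum_congr rfl fun i _ => ?_
    rw [intervalIntegral.integral_const_mul, integral_pow]
    simp [div_eq_mul_inv]
  · intro i _
    exact Continuous.intervalIntegrable (by fun_prop) _ _

theorem A_five_eq :
    (∫ x in (0:ℝ)..1, (4 + (1/256 : ℝ) * x ^ 20 * (1 - x) ^ 20) / (x ^ 2 + 1)) =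
      26856502742629699 / 8548690331301120 := by
  have h : ∀ x : ℝ, (4 + (1/256 : ℝ) * x ^ 20 * (1 - x) ^ 20) / (x ^ 2 + 1) =
      (1/256 : ℝ) * ∑ i ∈ Finset.range 39, (quotCoeff i : ℝ) * x ^ i := by
    intro x
    have hx : x ^ 2 + 1 ≠ 0 := by positivity
    rw [div_eq_iff hx]
    simp only [Finset.sum_range_succ, Finset.sum_range_zero, quotCoeff, List.getD_cons_zero,
      List.getD_cons_succ]
    push_cast
    ring
  simp_rw [h]
  rw [intervalIntegral.integral_const_mul, integral_quot]
  simp only [Finset.sum_range_succ, Finset.sum_range_zero, quotCoeff, List.getD_cons_zero,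
    List.getD_cons_succ]
  norm_num
end
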